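/- Let R be a ring with ℤ ⊆ R ⊆ ℚ, let n ≥ 5 be an integer and d > 0 a divisor of n, and let L_d denote Craig's integral representation of S_n of rank n−1 in which the transposition (k, k+1) acts by the matrix V_d^{−1} F_k V_d for 1 ≤ k ≤ n−1. Then the ring of invariants R[L_d]^{S_n} is isomorphic to a polynomial ring over R if and only if d/n ∈ R. -/

import Mathlib

set_option synthInstance.maxHeartbeats 1000000
set_option maxHeartbeats 1000000

open MvPolynomial

/-- The `(n-1) × (n-1)` rational matrix `E^{i,j}` (1-based indices `i`, `j`) whose
`(i,j)`-entry is `1` and all other entries are `0`; it is the zero matrix when `i` or `j`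
is out of the range `1, …, n-1`. -/
def Emat (n i j : ℕ) : Matrix (Fin (n - 1)) (Fin (n - 1)) ℚ :=
  Matrix.of fun a b => if (a : ℕ) + 1 = i ∧ (b : ℕ) + 1 = j then 1 else 0

/-- `F_k = I_{n-1} + E^{n-k-1,n-k} - 2 E^{n-k,n-k} + E^{n-k+1,n-k}`. -/
def Fmat (n k : ℕ) : Matrix (Fin (n - 1)) (Fin (n - 1)) ℚ :=
  1 + Emat n (n - k - 1) (n - k) - 2 • Emat n (n - k) (n - k) + Emat n (n - k + 1) (n - k)

/-- `V_d = d E^{1,1} + ∑_{i=2}^{n-1} (E^{i,i} + (n-i) E^{1,i})`. -/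
def Vmat (n d : ℕ) : Matrix (Fin (n - 1)) (Fin (n - 1)) ℚ :=
  d • Emat n 1 1 + ∑ i ∈ Finset.Icc 2 (n - 1), (Emat n i i + (n - i) • Emat n 1 i)

/-- The image of Craig's representation `L_d` of `S_n`: the subgroup of `GL_{n-1}(ℚ)`
generated by the images `V_d⁻¹ F_k V_d` of the adjacent transpositions `(k, k+1)`. -/
noncomputable def craigGroup (n d : ℕ) : Subgroup (GL (Fin (n - 1)) ℚ) :=
  Subgroup.closure {g | ∃ k, 1 ≤ k ∧ k ≤ n - 1 ∧
    (g : Matrix (Fin (n - 1)) (Fin (n - 1)) ℚ) = (Vmat n d)⁻¹ * Fmat n k * Vmat n d}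

/-- The algebra endomorphism of `ℚ[x_1, …, x_m]` given by the linear substitution
`x_i ↦ ∑_j M_{i,j} x_j` for a matrix `M`. -/
noncomputable def actQ {m : ℕ} (M : Matrix (Fin m) (Fin m) ℚ) :
    MvPolynomial (Fin m) ℚ →ₐ[ℚ] MvPolynomial (Fin m) ℚ :=
  aeval fun i => ∑ j, C (M i j) * X j

/-- For a subring `R ⊆ ℚ` and a subgroup `G ⊆ GL_m(ℚ)`, the invariant ring `R[x_1, …, x_m]^G`:
the `R`-subalgebra of `ℚ[x_1, …, x_m]` consisting of the polynomials with all coefficients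
in `R` that are fixed by the substitution action of every element of `G`. -/
noncomputable def invariantRingQ {m : ℕ} (R : Subring ℚ) (G : Subgroup (GL (Fin m) ℚ)) :
    Subalgebra ↥R (MvPolynomial (Fin m) ℚ) :=
  (MvPolynomial.mapAlgHom (R := ↥R) (σ := Fin m) (Algebra.ofId ↥R ℚ)).range ⊓
    Subalgebra.restrictScalars ↥R
      (⨅ g ∈ G, AlgHom.equalizer (actQ (g : Matrix (Fin m) (Fin m) ℚ)) (AlgHom.id ℚ _))

/-- `R[x_1, …, x_m]^G` is isomorphic to a polynomial ring over `R`. -/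
def IsPolynomialRingQ {m : ℕ} (R : Subring ℚ) (G : Subgroup (GL (Fin m) ℚ)) : Prop :=
  ∃ k : ℕ, Nonempty (↥(invariantRingQ R G) ≃ₐ[↥R] MvPolynomial (Fin k) ↥R)

/-- Let a finite group act on `S`, faithfully modulo `q` (the kernel of `φ`). If reduction modulo
`q` of the ring of invariants `A` is an integrally closed domain, then every element of `S` that is
invariant modulo `q` is congruent modulo `q` to an invariant element. -/
theorem exists_invariant_congruent {G S T A P : Type*} [Group G] [Finite G]
    [CommRing S] [IsDomain S] [CommRing T] [IsDomain T] [CommRing A]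
    [CommRing P] [IsDomain P] [IsIntegrallyClosed P]
    (τ : G → S →+* S) (τ_mul : ∀ g h x, τ (g * h) x = τ g (τ h x)) (τ_one : ∀ x, τ 1 x = x)
    (φ : S →+* T) (q : S) (hq : q ≠ 0) (hφ : ∀ x, φ x = 0 ↔ q ∣ x)
    (hτq : ∀ g, τ g q = q) (faithful : ∀ g, g ≠ 1 → ∃ x, φ (τ g x) ≠ φ x)
    (j : A →+* S) (j_inj : Function.Injective j)
    (mem_range_j : ∀ x, (∃ a, j a = x) ↔ ∀ g, τ g x = x) (qA : A) (hqA : j qA = q)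
    (ψ : A →+* P) (ψ_surj : Function.Surjective ψ) (hψ : ∀ a, ψ a = 0 ↔ qA ∣ a)
    (z : S) (hz : ∀ g, φ (τ g z) = φ z) : ∃ w : A, φ (j w) = φ z := by
  classical
  have := Fintype.ofFinite G
  have τ_sum : ∀ x, ∃ a, j a = ∑ g, τ g x := fun x => by
    rw [mem_range_j]
    intro h
    simp only [map_sum, ← τ_mul]
    exact Equiv.sum_comp (Equiv.mulLeft h) fun g => τ g x
  have τ_prod : ∀ x, ∃ a, j a = ∏ g, τ g x := fun x => by
    rw [mem_range_j]
    intro h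
    simp only [map_prod, ← τ_mul]
    exact Equiv.prod_comp (Equiv.mulLeft h) fun g => τ g x
  obtain ⟨y, hy⟩ : ∃ y, ∑ g, φ (τ g y) ≠ 0 := by
    by_contra! hcon
    let ev : G → (S →* T) := fun g => (φ.comp (τ g) : S →+* T)
    have ev_inj : Function.Injective ev := by
      intro g h hgh
      by_contra hne
      obtain ⟨x, hx⟩ := faithful (g * h⁻¹) (by rwa [Ne, mul_inv_eq_one])
      apply hx
      have h1 := DFunLike.congr_fun hgh (τ h⁻¹ x)
      change φ (τ g (τ h⁻¹ x)) = φ (τ h (τ h⁻¹ x)) at h1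
      rwa [← τ_mul, ← τ_mul, mul_inv_cancel, τ_one] at h1
    have li := (linearIndependent_monoidHom S T).comp ev ev_inj
    rw [Fintype.linearIndependent_iff] at li
    refine one_ne_zero (li (fun _ => (1 : T)) ?_ 1)
    funext x
    simpa [ev] using hcon x
  obtain ⟨b, hb⟩ := τ_sum y
  obtain ⟨a, ha⟩ := τ_sum (z * y)
  obtain ⟨N, hN⟩ := τ_prod z
  have hb0 : φ (j b) ≠ 0 := by rwa [hb, map_sum]
  have hab : φ (j a) = φ z * φ (j b) := by
    simp only [ha, hb, map_sum, map_mul, hz, Finset.mul_sum]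
  have hNz : φ (j N) = φ z ^ Fintype.card G := by
    simp [hN, map_prod, hz, Finset.card_univ]
  have hτj : ∀ g x, τ g (j x) = j x := fun g x => (mem_range_j _).1 ⟨x, rfl⟩ g
  have descend : ∀ x, φ (j x) = 0 → qA ∣ x := by
    intro x hx
    obtain ⟨y, hy⟩ := (hφ _).1 hx
    obtain ⟨y', rfl⟩ : ∃ a, j a = y := by
      rw [mem_range_j]
      intro g
      apply mul_left_cancel₀ hq
      rw [← hy, ← hτj g x, hy, map_mul, hτq]
    refine ⟨y', j_inj ?_⟩
    rw [hy, map_mul, hqA]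
  have hpow : ψ a ^ Fintype.card G = ψ N * ψ b ^ Fintype.card G := by
    rw [← sub_eq_zero, ← map_pow, ← map_pow, ← map_mul, ← map_sub, hψ]
    apply descend
    simp only [map_sub, map_mul, map_pow, hab, hNz]
    ring
  have hdvd : ψ b ∣ ψ a :=
    (IsIntegrallyClosed.pow_dvd_pow_iff Fintype.card_ne_zero).1
      ⟨ψ N, by rw [hpow, mul_comm]⟩
  obtain ⟨w', hw'⟩ := hdvd
  obtain ⟨w, rfl⟩ := ψ_surj w'
  refine ⟨w, mul_right_cancel₀ hb0 ?_⟩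
  rw [← map_mul, ← sub_eq_zero, ← map_sub, hψ] at hw'
  obtain ⟨u, hu⟩ := hw'
  have := congrArg (fun x => φ (j x)) hu
  simp only [map_sub, map_mul, hqA, (hφ q).2 dvd_rfl, zero_mul, hab] at this
  linear_combination -this

/-- Every ideal of a subring of `ℚ` is generated by an integer. -/
theorem Subring.exists_eq_span_intCast (R : Subring ℚ) (I : Ideal R) :
    ∃ q : ℤ, I = Ideal.span {(q : R)} := by
  obtain ⟨q, hq⟩ := (IsPrincipalIdealRing.principal (I.comap (Int.castRingHom R))).principal
  have hmem : ∀ a : ℤ, (a : R) ∈ I ↔ q ∣ a := fun a => by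
    rw [← Ideal.mem_span_singleton, ← Ideal.submodule_span_eq, ← hq]
    simp [Ideal.mem_comap]
  refine ⟨q, le_antisymm (fun x hx => ?_) ?_⟩
  · have hcop : IsCoprime (x : ℚ).num ((x : ℚ).den : ℤ) :=
      Int.isCoprime_iff_gcd_eq_one.2 (x : ℚ).reduced
    obtain ⟨u, v, huv⟩ := hcop
    have hx' : (x : ℚ) * (x : ℚ).den = (x : ℚ).num := Rat.mul_den_eq_num _
    have hden : ((x : ℚ).den : ℚ) ≠ 0 := by exact_mod_cast (x : ℚ).den_ne_zero
    have huv' : (u : ℚ) * (x : ℚ).num + v * (x : ℚ).den = 1 := by exact_mod_cast huv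
    let e : R := u * x + v
    have he : (e : ℚ) * (x : ℚ).den = 1 := by
      simp only [e, Subring.coe_add, Subring.coe_mul, Subring.coe_intCast]
      rw [add_mul, mul_assoc, hx', huv']
    have hnum : ((x : ℚ).num : R) = x * ((x : ℚ).den : R) :=
      Subtype.ext (by push_cast; exact hx'.symm)
    have hdvd : q ∣ (x : ℚ).num := (hmem _).1 (hnum ▸ I.mul_mem_right _ hx)
    obtain ⟨k, hk⟩ := hdvd
    rw [Ideal.mem_span_singleton]
    refine ⟨k * e, Subtype.ext ?_⟩
    push_cast
    have hk' : ((x : ℚ).num : ℚ) = q * k := by exact_mod_cast hk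
    rw [← mul_assoc, ← hk', ← hx', mul_assoc, mul_comm _ (e : ℚ), he, mul_one]
  · rw [Ideal.span_singleton_le_iff_mem]
    exact (hmem q).2 dvd_rfl

/-- A positive integer that is not invertible in a subring of `ℚ` vanishes in some residue field,
and the kernel of the residue map is principal. -/
theorem Subring.exists_residueField (R : Subring ℚ) {c : ℕ} (hc : c ≠ 0)
    (hcR : (c : ℚ)⁻¹ ∉ R) :
    ∃ (κ : Type) (_ : Field κ) (ρ : R →+* κ) (q : R), q ≠ 0 ∧ Function.Surjective ρ ∧
      (∀ r, ρ r = 0 ↔ q ∣ r) ∧ ρ c = 0 := by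
  have hunit : (c : R) ∈ nonunits R := by
    rw [mem_nonunits_iff, isUnit_iff_exists_inv]
    rintro ⟨b, hb⟩
    apply hcR
    have : (c : ℚ) * b = 1 := by exact_mod_cast congrArg (Subtype.val) hb
    rw [inv_eq_of_mul_eq_one_right this]
    exact b.2
  obtain ⟨I, hI, hcI⟩ := exists_max_ideal_of_mem_nonunits hunit
  obtain ⟨q, rfl⟩ := R.exists_eq_span_intCast I
  refine ⟨R ⧸ Ideal.span {(q : R)}, Ideal.Quotient.field _, Ideal.Quotient.mk _, q, ?_,
    Ideal.Quotient.mk_surjective, fun r => ?_, Ideal.Quotient.eq_zero_iff_mem.2 hcI⟩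
  · intro h0
    rw [Ideal.mem_span_singleton, h0, zero_dvd_iff] at hcI
    exact hc (by exact_mod_cast hcI)
  · exact Ideal.Quotient.eq_zero_iff_mem.trans Ideal.mem_span_singleton

namespace MvPolynomial

/-- The coefficient of `X` under a linear substitution into one variable. -/
theorem coeff_one_aeval_linear {σ A K : Type*} [Fintype σ] [CommRing A] [CommRing K]
    [Algebra A K] (r : σ → K) (f : MvPolynomial σ A) :
    (aeval (fun i => Polynomial.C (r i) * Polynomial.X) f : Polynomial K).coeff 1
      = ∑ i, r i * algebraMap A K (coeff (Finsupp.single i 1) f) := by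
  classical
  have h0 : ∀ f : MvPolynomial σ A,
      (aeval (fun i => Polynomial.C (r i) * Polynomial.X) f : Polynomial K).coeff 0
        = algebraMap A K (coeff 0 f) := by
    intro f
    induction f using MvPolynomial.induction_on with
    | C a => simp [Polynomial.algebraMap_apply]
    | add p q hp hq => simp [hp, hq]
    | mul_X p i hp => simp [coeff_mul_X']
  induction f using MvPolynomial.induction_on with
  | C a => simp [Polynomial.algebraMap_apply, coeff_C, eq_comm]
  | add p q hp hq => simp [hp, hq, mul_add, Finset.sum_add_distrib]
  | mul_X p i hp =>
    rw [map_mul, aeval_X, ← mul_assoc, Polynomial.coeff_mul_X, mul_comm, Polynomial.coeff_C_mul,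
      h0, Finset.sum_eq_single i]
    · simp [coeff_mul_X']
    · intro k _ hk
      simp [coeff_mul_X', hk.symm]
    · simp

theorem IsSymmetric.coeff_single {σ K : Type*} [CommRing K] {f : MvPolynomial σ K}
    (hf : f.IsSymmetric) (i k : σ) :
    coeff (Finsupp.single i 1) f = coeff (Finsupp.single k 1) f := by
  classical
  have := coeff_rename_mapDomain (Equiv.swap i k) (Equiv.injective _) f (Finsupp.single i 1)
  rw [hf, Finsupp.mapDomain_single, Equiv.swap_apply_left] at this
  exact this.symm

theorem isRegular_sum_X {m : ℕ} {K : Type*} [CommRing K] :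
    IsRegular (∑ i, X i : MvPolynomial (Fin (m + 1)) K) := by
  let f : MvPolynomial (Fin (m + 1)) K →ₐ[K] MvPolynomial (Fin (m + 1)) K :=
    aeval (Fin.cons (∑ i, X i) fun i => X i.succ)
  let g : MvPolynomial (Fin (m + 1)) K →ₐ[K] MvPolynomial (Fin (m + 1)) K :=
    aeval (Fin.cons (X 0 - ∑ i : Fin m, X i.succ) fun i => X i.succ)
  have hfg : ∀ p, f (g p) = p := fun p => by
    refine DFunLike.congr_fun (?_ : f.comp g = AlgHom.id K _) p
    ext1 i
    refine Fin.cases ?_ (fun i => ?_) i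
    · simp [f, g, Fin.sum_univ_succ]
    · simp [f, g]
  have hgf : ∀ p, g (f p) = p := fun p => by
    refine DFunLike.congr_fun (?_ : g.comp f = AlgHom.id K _) p
    ext1 i
    refine Fin.cases ?_ (fun i => ?_) i
    · simp [f, g, Fin.sum_univ_succ]
    · simp [f, g]
  have hf0 : g (∑ i, X i) = X 0 := by rw [← hgf (X 0)]; simp [f]
  suffices IsLeftRegular (∑ i, X i : MvPolynomial (Fin (m + 1)) K) from
    ⟨this, this.right_of_commute <| Commute.all _⟩
  intro p p' h
  have := congrArg g h
  simp only [map_mul, hf0] at this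
  have := isRegular_X.left this
  rw [← hfg p, this, hfg]

/-- The elementary symmetric polynomials of degree at least two are algebraically independent
modulo the first one. -/
theorem eq_zero_of_sum_X_dvd_aeval_esymm {m : ℕ} {K : Type*} [CommRing K]
    (F : MvPolynomial (Fin m) K)
    (h : (∑ i, X i : MvPolynomial (Fin (m + 1)) K) ∣
      aeval (fun i : Fin m => esymm (Fin (m + 1)) K (i + 2)) F) : F = 0 := by
  obtain ⟨p, hp⟩ := h
  have hsum : (∑ i, X i : MvPolynomial (Fin (m + 1)) K) = esymm (Fin (m + 1)) K 1 := by
    rw [esymm_one]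
  have hF : (aeval (fun i : Fin m => esymm (Fin (m + 1)) K (i + 2)) F).IsSymmetric := by
    intro e
    rw [← AlgHom.comp_apply, comp_aeval]
    simp only [rename_esymm]
  have hps : p.IsSymmetric := by
    intro e
    apply isRegular_sum_X.left
    change (∑ i, X i) * rename e p = (∑ i, X i) * p
    rw [← hp, ← hF e, hp, map_mul, hsum, rename_esymm]
  obtain ⟨H, hH⟩ := esymmAlgHom_surjective (n := m + 1) (σ := Fin (m + 1)) K (by simp) ⟨p, hps⟩
  have hHp : aeval (fun i : Fin (m + 1) => esymm (Fin (m + 1)) K (i + 1)) H = p := by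
    rw [← esymmAlgHom_apply, hH]
  have key : rename Fin.succ F = X 0 * H := by
    apply esymmAlgHom_injective (n := m + 1) (σ := Fin (m + 1)) K (by simp)
    apply Subtype.ext
    rw [esymmAlgHom_apply, esymmAlgHom_apply, aeval_rename, map_mul, hHp, aeval_X]
    simp only [Fin.val_zero, zero_add, ← hsum, ← hp]
    rfl
  have := congrArg (aeval (Fin.cons 0 X : Fin (m + 1) → MvPolynomial (Fin m) K)) key
  rw [aeval_rename, map_mul, aeval_X, Fin.cons_zero, zero_mul] at this
  rwa [show (Fin.cons 0 X : Fin (m + 1) → MvPolynomial (Fin m) K) ∘ Fin.succ = X from rfl,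
    aeval_X_left_apply] at this

end MvPolynomial

namespace Craig

/-- The linear forms in `t_0, …, t_{m+1}` spanning a copy of Craig's lattice: a multiple of a
fundamental weight followed by simple roots. -/
noncomputable def linForm (m c : ℕ) : Fin (m + 1) → MvPolynomial (Fin (m + 2)) ℚ :=
  Fin.cons (-C (c : ℚ) * (X 1 - C ((m + 2 : ℚ)⁻¹) * ∑ i, X i))
    fun b : Fin m => X b.succ.castSucc - X b.succ.succ

/-- The substitution realising Craig's lattice inside the permutation representation. -/
noncomputable def embed (m c : ℕ) (R : Subring ℚ) :
    MvPolynomial (Fin (m + 1)) R →ₐ[R] MvPolynomial (Fin (m + 2)) ℚ :=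
  aeval (linForm m c)

/-- The rational version of `embed`. -/
noncomputable def embedRat (m c : ℕ) :
    MvPolynomial (Fin (m + 1)) ℚ →ₐ[ℚ] MvPolynomial (Fin (m + 2)) ℚ :=
  aeval (linForm m c)

theorem embedRat_map (m c : ℕ) (R : Subring ℚ) (f : MvPolynomial (Fin (m + 1)) R) :
    embedRat m c (mapAlgHom (Algebra.ofId R ℚ) f) = embed m c R f := by
  simp only [embedRat, embed, mapAlgHom_apply, aeval_def, eval₂_map]
  rfl

theorem embedRat_injective (m : ℕ) {c : ℕ} (hc : c ≠ 0) :
    Function.Injective (embedRat m c) := by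
  let w : Fin (m + 1) → MvPolynomial (Fin (m + 1)) ℚ := fun i =>
    -C ((c : ℚ)⁻¹) * X 0 - ∑ b : Fin m, if (b : ℕ) < i then X b.succ else 0
  let g : MvPolynomial (Fin (m + 2)) ℚ →ₐ[ℚ] MvPolynomial (Fin (m + 1)) ℚ :=
    aeval (Fin.cons (-∑ i, w i) w)
  have hsum : g (∑ i, X i) = 0 := by
    simp [g, Fin.sum_univ_succ (n := m + 1)]
  have hg : g.comp (embedRat m c) = AlgHom.id ℚ _ := by
    ext1 b
    refine Fin.cases ?_ (fun b => ?_) b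
    · rw [AlgHom.comp_apply, embedRat, aeval_X, linForm, Fin.cons_zero, map_mul, map_sub,
        map_mul, hsum]
      have h1 : g (X 1) = w 0 := by
        rw [← Fin.succ_zero_eq_one]
        simp [g]
      have h2 : (C (c : ℚ) * C ((c : ℚ)⁻¹) : MvPolynomial (Fin (m + 1)) ℚ) = 1 := by
        rw [← C_mul, mul_inv_cancel₀ (by exact_mod_cast hc), C_1]
      rw [h1, map_neg, ← algebraMap_eq, AlgHom.commutes, algebraMap_eq]
      simp only [w, Fin.val_zero, not_lt_zero, if_false, Finset.sum_const_zero, AlgHom.id_apply]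
      linear_combination X 0 * h2
    · rw [AlgHom.comp_apply, embedRat, aeval_X, linForm, Fin.cons_succ, map_sub,
        ← Fin.succ_castSucc]
      simp only [g, aeval_X, Fin.cons_succ, w, AlgHom.id_apply, sub_sub_sub_cancel_left]
      rw [← Finset.sum_sub_distrib, Finset.sum_eq_single b]
      · simp
      · intro k _ hk
        have : (k : ℕ) ≠ b := fun h => hk (Fin.ext h)
        simp only [Fin.val_castSucc, Fin.val_succ]
        by_cases h : (k : ℕ) < b
        · rw [if_pos h, if_pos (by omega), sub_self]
        · rw [if_neg h, if_neg (by omega), sub_self]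
      · simp
  intro f f' h
  have := congrArg g h
  rwa [← AlgHom.comp_apply, ← AlgHom.comp_apply, hg] at this

theorem embed_injective (m : ℕ) {c : ℕ} (hc : c ≠ 0) (R : Subring ℚ) :
    Function.Injective (embed m c R) := by
  intro f f' h
  rw [← embedRat_map, ← embedRat_map] at h
  exact map_injective (Algebra.ofId R ℚ : R →+* ℚ) Subtype.val_injective
    (embedRat_injective m hc h)

/-- `Vmat (m + 2) d` with its index type in simplified form. -/
def vMat (m d : ℕ) : Matrix (Fin (m + 1)) (Fin (m + 1)) ℚ := Vmat (m + 2) d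

/-- `Fmat (m + 2) k` with its index type in simplified form, for `k = m + 1 - a`. -/
def fMat (m : ℕ) (a : Fin (m + 1)) : Matrix (Fin (m + 1)) (Fin (m + 1)) ℚ :=
  Fmat (m + 2) (m + 1 - a)

theorem vMat_apply (m d : ℕ) (a b : Fin (m + 1)) :
    vMat m d a b =
      if a = 0 then (if b = 0 then (d : ℚ) else ((m + 1 - b : ℕ) : ℚ))
      else if a = b then 1 else 0 := by
  have key : ∀ i ∈ Finset.Icc 2 (m + 1),
      (Emat (m + 2) i i + (m + 2 - i) • Emat (m + 2) 1 i) a b =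
        if (b : ℕ) + 1 = i then
          ((if a = b then 1 else 0) + (if a = 0 then ((m + 1 - b : ℕ) : ℚ) else 0)) else 0 := by
    intro i _
    have e1 : (a = b) ↔ (a : ℕ) = b := Fin.ext_iff
    have e2 : (a = 0) ↔ (a : ℕ) = 0 := Fin.ext_iff
    simp only [Emat, Matrix.add_apply, Matrix.smul_apply, Matrix.of_apply, e1, e2]
    by_cases h : (b : ℕ) + 1 = i
    · subst h
      simp [show m + 2 - ((b : ℕ) + 1) = m + 1 - b by omega]
    · simp [h]
  have e2 : (a = 0) ↔ (a : ℕ) = 0 := Fin.ext_iff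
  have e3 : (b = 0) ↔ (b : ℕ) = 0 := Fin.ext_iff
  have hsum : ∑ i ∈ Finset.Icc 2 (m + 2 - 1),
      (Emat (m + 2) i i + (m + 2 - i) • Emat (m + 2) 1 i) a b
      = _ := Finset.sum_congr rfl key
  rw [Finset.sum_ite_eq] at hsum
  rw [vMat, Vmat, Matrix.add_apply, Matrix.sum_apply, hsum]
  have hb := b.2
  simp only [Emat, Matrix.smul_apply, Matrix.of_apply, Finset.mem_Icc]
  by_cases ha0 : a = 0 <;> by_cases hb0 : b = 0
  · simp [ha0, hb0]
  · have : (b : ℕ) ≠ 0 := fun h => hb0 (e3.2 h)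
    rw [if_pos (show 2 ≤ (b : ℕ) + 1 ∧ (b : ℕ) + 1 ≤ m + 2 - 1 by omega)]
    simp [ha0, hb0, Ne.symm hb0]
  · simp [ha0, hb0]
  · have : (b : ℕ) ≠ 0 := fun h => hb0 (e3.2 h)
    rw [if_pos (show 2 ≤ (b : ℕ) + 1 ∧ (b : ℕ) + 1 ≤ m + 2 - 1 by omega)]
    simp [ha0]

theorem vMat_det_ne_zero (m : ℕ) {d : ℕ} (hd : d ≠ 0) : (vMat m d).det ≠ 0 := by
  have htri : ∀ a b : Fin (m + 1), b < a → vMat m d a b = 0 := fun a b hab => by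
    rw [vMat_apply, if_neg (Fin.ne_zero_of_lt hab), if_neg hab.ne']
  rw [Matrix.det_of_isUpperTriangular (fun a b hab => htri a b hab)]
  refine Finset.prod_ne_zero_iff.2 fun (a : Fin (m + 1)) _ => ?_
  rw [vMat_apply]
  by_cases ha : a = 0 <;> simp [ha, hd]

theorem fMat_apply (m : ℕ) (a x b : Fin (m + 1)) :
    fMat m a x b = (if x = b then 1 else 0) +
      if b = a then ((if (x : ℕ) + 1 = a then 1 else 0) - (if x = a then 2 else 0) +
        (if (x : ℕ) = a + 1 then 1 else 0) : ℚ) else 0 := by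
  have ha := a.2
  have h1 : m + 2 - (m + 1 - (a : ℕ)) - 1 = a := by omega
  have h2 : m + 2 - (m + 1 - (a : ℕ)) = a + 1 := by omega
  have e1 : (b = a) ↔ (b : ℕ) = a := Fin.ext_iff
  have e2 : (x = a) ↔ (x : ℕ) = a := Fin.ext_iff
  rw [fMat, Fmat, h1, h2]
  simp only [Emat, Matrix.add_apply, Matrix.sub_apply, Matrix.smul_apply, Matrix.of_apply,
    Matrix.one_apply, e1, e2, add_left_inj]
  by_cases h : (b : ℕ) = a
  · by_cases h' : (x : ℕ) = a <;> simp [h, h'] <;> ring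
  · simp [h]

theorem fMat_mul_self (m : ℕ) (a : Fin (m + 1)) :
    fMat m a * fMat m a = 1 := by
  ext x y
  rw [Matrix.mul_apply, Matrix.one_apply]
  simp only [fMat_apply, mul_add, add_mul, Finset.sum_add_distrib]
  simp only [mul_ite, ite_mul, mul_zero, zero_mul, mul_one, one_mul, Finset.sum_ite_eq',
    Finset.mem_univ, if_true]
  by_cases h : y = a
  · subst h
    simp
    ring
  · simp [h]

theorem sum_telescope {A : Type*} [CommRing A] (m : ℕ) (f : Fin (m + 1) → A) :
    ∑ b : Fin m, ((m - b : ℕ) : A) * (f b.castSucc - f b.succ)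
      = (m + 1) * f 0 - ∑ i, f i := by
  induction m with
  | zero => simp
  | succ m ih =>
    rw [Fin.sum_univ_succ, Fin.sum_univ_succ (n := m + 1)]
    have := ih fun i => f i.succ
    simp only [Fin.val_succ, Nat.add_sub_add_right, ← Fin.succ_castSucc, Fin.succ_zero_eq_one,
      Fin.castSucc_zero, Fin.val_zero, Nat.sub_zero] at this ⊢
    rw [this]
    push_cast
    ring

/-- The matrix `V_d` takes the chosen basis of linear forms to the simple roots. -/
theorem sum_vMat_mul_linForm {m c d : ℕ} (hcd : c * d = m + 2) (a : Fin (m + 1)) :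
    ∑ b, C (vMat m d a b) * linForm m c b = X a.castSucc - X a.succ := by
  refine Fin.cases ?_ (fun a => ?_) a
  · rw [Fin.sum_univ_succ]
    simp only [vMat_apply, linForm, Fin.cons_zero, Fin.cons_succ, if_true, Fin.succ_ne_zero,
      if_false, Fin.val_succ, Nat.add_sub_add_right, ← Fin.succ_castSucc]
    have := sum_telescope m fun i => (X i.succ : MvPolynomial (Fin (m + 2)) ℚ)
    simp only [map_natCast, Fin.succ_zero_eq_one] at this ⊢
    rw [this, Fin.sum_univ_succ (n := m + 1), Fin.castSucc_zero]
    have h1 : (d : MvPolynomial (Fin (m + 2)) ℚ) * c = m + 2 := by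
      rw [mul_comm]; exact_mod_cast congrArg (Nat.cast) hcd
    have h2 : (m + 2 : MvPolynomial (Fin (m + 2)) ℚ) * C ((m + 2 : ℚ)⁻¹) = 1 := by
      have : (m + 2 : MvPolynomial (Fin (m + 2)) ℚ) = C (m + 2 : ℚ) := by
        simp only [map_add, map_natCast, add_right_inj]
        exact (map_ofNat C 2).symm
      rw [this, ← C_mul, mul_inv_cancel₀ (by positivity), C_1]
    linear_combination (-X 1 + C ((m + 2 : ℚ)⁻¹) * (X 0 + ∑ i : Fin (m + 1), X i.succ)) * h1
      + (X 0 + ∑ i : Fin (m + 1), X i.succ) * h2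
  · rw [Finset.sum_eq_single a.succ]
    · simp [vMat_apply, linForm]
    · intro k _ hk
      simp [vMat_apply, hk.symm]
    · simp

/-- The matrix `F_k` describes the action of an adjacent transposition on the simple roots. -/
theorem sum_fMat_mul_root {m : ℕ} (a x : Fin (m + 1)) :
    ∑ b : Fin (m + 1), C (fMat m a x b) *
        (X b.castSucc - X b.succ : MvPolynomial (Fin (m + 2)) ℚ)
      = rename (Equiv.swap a.castSucc a.succ) (X x.castSucc - X x.succ) := by
  simp only [fMat_apply, map_add, add_mul, Finset.sum_add_distrib, apply_ite C, C_0, C_1,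
    ite_mul, zero_mul, one_mul, Finset.sum_ite_eq, Finset.sum_ite_eq', Finset.mem_univ, if_true,
    map_sub, rename_X]
  rcases lt_trichotomy (x : ℕ) a with h | h | h
  · rw [if_neg (show x ≠ a by rintro rfl; omega), if_neg (show (x : ℕ) ≠ a + 1 by omega),
      Equiv.swap_apply_of_ne_of_ne (a := a.castSucc) (b := a.succ) (x := x.castSucc)
        (by simp [Fin.ext_iff]; omega) (by simp [Fin.ext_iff]; omega)]
    by_cases h' : (x : ℕ) + 1 = a
    · have e : x.succ = a.castSucc := Fin.ext (by simp [h'])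
      rw [if_pos h', e, Equiv.swap_apply_left]
      simp
    · rw [if_neg h', Equiv.swap_apply_of_ne_of_ne (x := x.succ)
        (by simp [Fin.ext_iff]; omega) (by simp [Fin.ext_iff]; omega)]
      simp
  · obtain rfl : x = a := Fin.ext h
    have h2 : (C 2 : MvPolynomial (Fin (m + 2)) ℚ) = 2 := map_ofNat C 2
    simp only [Equiv.swap_apply_left, Equiv.swap_apply_right, if_true, h2]
    rw [if_neg (by omega), if_neg (by omega)]
    ring
  · rw [if_neg (show x ≠ a by rintro rfl; omega), if_neg (show (x : ℕ) + 1 ≠ a by omega),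
      Equiv.swap_apply_of_ne_of_ne (a := a.castSucc) (b := a.succ) (x := x.succ)
        (by simp [Fin.ext_iff]; omega) (by simp [Fin.ext_iff]; omega)]
    by_cases h' : (x : ℕ) = a + 1
    · have e : x.castSucc = a.succ := Fin.ext (by simp [h'])
      rw [if_pos h', e, Equiv.swap_apply_right]
      simp
    · rw [if_neg h', Equiv.swap_apply_of_ne_of_ne (x := x.castSucc)
        (by simp [Fin.ext_iff]; omega) (by simp [Fin.ext_iff]; omega)]
      simp

end Craig

/-- Substitutions compose contravariantly. -/
theorem actQ_mul {m : ℕ} (M N : Matrix (Fin m) (Fin m) ℚ) (f : MvPolynomial (Fin m) ℚ) :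
    actQ (M * N) f = actQ N (actQ M f) := by
  refine DFunLike.congr_fun (?_ : actQ (M * N) = (actQ N).comp (actQ M)) f
  ext1 i
  simp only [actQ, AlgHom.comp_apply, aeval_X, map_sum, map_mul, Matrix.mul_apply,
    Finset.sum_mul, Finset.mul_sum, ← algebraMap_eq, AlgHom.commutes]
  rw [Finset.sum_comm]
  simp only [mul_assoc]

theorem actQ_one {m : ℕ} (f : MvPolynomial (Fin m) ℚ) :
    actQ (1 : Matrix (Fin m) (Fin m) ℚ) f = f := by
  refine DFunLike.congr_fun (?_ : actQ (1 : Matrix (Fin m) (Fin m) ℚ) = AlgHom.id ℚ _) f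
  ext1 i
  simp [actQ, Matrix.one_apply, apply_ite C]

namespace Craig

theorem embedRat_actQ {m c d : ℕ} (hcd : c * d = m + 2) (a : Fin (m + 1))
    (M : Matrix (Fin (m + 1)) (Fin (m + 1)) ℚ) (hM : M = (vMat m d)⁻¹ * fMat m a * vMat m d)
    (f : MvPolynomial (Fin (m + 1)) ℚ) :
    embedRat m c (actQ M f) = rename (Equiv.swap a.castSucc a.succ) (embedRat m c f) := by
  have hd : d ≠ 0 := by rintro rfl; simp at hcd
  have hV := vMat_det_ne_zero m hd
  have hVM : vMat m d * M = fMat m a * vMat m d := by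
    rw [hM, Matrix.mul_assoc, Matrix.mul_nonsing_inv_cancel_left _ _ hV.isUnit]
  set e := Equiv.swap a.castSucc a.succ
  let K := MvPolynomial (Fin (m + 2)) ℚ
  let δ : Fin (m + 1) → K := fun i => ∑ j, C (M i j) * linForm m c j - rename e (linForm m c i)
  have hδ : δ = 0 := by
    apply Matrix.eq_zero_of_mulVec_eq_zero (M := (vMat m d).map (C : ℚ → K))
    · have : ((vMat m d).map (C : ℚ → K)).det = C (vMat m d).det :=
        (RingHom.map_det (C : ℚ →+* K) (vMat m d)).symm
      rw [this]
      simpa using hV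
    · funext x
      change ∑ i, C (vMat m d x i) * (∑ j, C (M i j) * linForm m c j - rename e (linForm m c i))
        = 0
      have h1 : ∑ i, C (vMat m d x i) * ∑ j, C (M i j) * linForm m c j
          = ∑ j, C ((vMat m d * M) x j) * linForm m c j := by
        simp only [Matrix.mul_apply, map_sum, map_mul, Finset.sum_mul, Finset.mul_sum, mul_assoc]
        exact Finset.sum_comm
      have h2 : ∑ j, C ((fMat m a * vMat m d) x j) * linForm m c j
          = ∑ b, C (fMat m a x b) * ∑ j, C (vMat m d b j) * linForm m c j := by
        simp only [Matrix.mul_apply, map_sum, map_mul, Finset.sum_mul, Finset.mul_sum, mul_assoc]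
        exact Finset.sum_comm
      have h3 : ∑ i, C (vMat m d x i) * rename e (linForm m c i)
          = rename e (∑ i, C (vMat m d x i) * linForm m c i) := by
        simp only [map_sum, map_mul, rename_C]
      simp only [mul_sub, Finset.sum_sub_distrib]
      rw [h1, hVM, h2, h3]
      simp only [sum_vMat_mul_linForm hcd]
      rw [sum_fMat_mul_root, sub_self]
  refine DFunLike.congr_fun
    (?_ : (embedRat m c).comp (actQ M) = (rename e).comp (embedRat m c)) f
  ext1 i
  have := congrFun hδ i
  simp only [δ, Pi.zero_apply, sub_eq_zero] at this
  simp only [actQ, embedRat, AlgHom.comp_apply, aeval_X, map_sum, map_mul, ← this,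
    ← algebraMap_eq, AlgHom.commutes]

/-- `craigGroup (m + 2) d` with its index type in simplified form. -/
noncomputable def group (m d : ℕ) : Subgroup (GL (Fin (m + 1)) ℚ) :=
  Subgroup.closure {g : GL (Fin (m + 1)) ℚ | ∃ a : Fin (m + 1),
    (g : Matrix (Fin (m + 1)) (Fin (m + 1)) ℚ) = (vMat m d)⁻¹ * fMat m a * vMat m d}

theorem craigGroup_eq (m d : ℕ) :
    (craigGroup (m + 2) d : Subgroup (GL (Fin (m + 1)) ℚ)) = group m d := by
  let F : ℕ → Matrix (Fin (m + 1)) (Fin (m + 1)) ℚ := Fmat (m + 2)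
  have hset : {g : GL (Fin (m + 1)) ℚ | ∃ k, 1 ≤ k ∧ k ≤ m + 2 - 1 ∧
      (g : Matrix (Fin (m + 1)) (Fin (m + 1)) ℚ) =
        (vMat m d)⁻¹ * F k * vMat m d}
      = {g : GL (Fin (m + 1)) ℚ | ∃ a : Fin (m + 1), (g : Matrix (Fin (m + 1)) (Fin (m + 1)) ℚ) =
          (vMat m d)⁻¹ * fMat m a * vMat m d} := by
    ext g
    constructor
    · rintro ⟨k, hk1, hk2, hg⟩
      refine ⟨⟨m + 1 - k, by omega⟩, ?_⟩
      have ha : m + 1 - (m + 1 - k) = k := by omega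
      rw [hg, fMat]
      simp only [ha, F]
    · rintro ⟨a, hg⟩
      have ha := a.2
      exact ⟨m + 1 - a, by omega, by omega, hg⟩
  exact congrArg Subgroup.closure hset

theorem fixed_iff_isSymmetric {m c d : ℕ} (hcd : c * d = m + 2)
    (f : MvPolynomial (Fin (m + 1)) ℚ) :
    (∀ g ∈ group m d,
      actQ (g : Matrix (Fin (m + 1)) (Fin (m + 1)) ℚ) f = f) ↔
      (embedRat m c f).IsSymmetric := by
  have hd : d ≠ 0 := by rintro rfl; simp at hcd
  have hc : c ≠ 0 := by rintro rfl; simp at hcd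
  have hV := vMat_det_ne_zero m hd
  constructor
  · intro h e
    have he : e ∈ Submonoid.closure
        (Set.range fun i : Fin (m + 1) => Equiv.swap i.castSucc i.succ) := by
      rw [Equiv.Perm.mclosure_swap_castSucc_succ]
      trivial
    induction he using Submonoid.closure_induction with
    | mem e he =>
      obtain ⟨a, rfl⟩ := he
      have hF : (fMat m a).det ≠ 0 := fun h0 => by
        have := congrArg Matrix.det (fMat_mul_self m a)
        simp [Matrix.det_mul, h0] at this
      let M : Matrix (Fin (m + 1)) (Fin (m + 1)) ℚ := (vMat m d)⁻¹ * fMat m a * vMat m d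
      have hM : M.det ≠ 0 := by
        simp only [M, Matrix.det_mul]
        exact mul_ne_zero (mul_ne_zero (by
          simpa [Matrix.det_nonsing_inv, Ring.inverse_eq_inv'] using hV) hF) hV
      have := h (Matrix.GeneralLinearGroup.mkOfDetNeZero M hM)
        (Subgroup.subset_closure ⟨a, rfl⟩)
      rw [← embedRat_actQ hcd a M rfl]
      exact congrArg _ this
    | one => simp
    | mul x y _ _ hx hy =>
      rw [Equiv.Perm.coe_mul, ← rename_rename, hy, hx]
  · intro h g hg
    induction hg using Subgroup.closure_induction with
    | mem g hg =>
      obtain ⟨a, hg⟩ := hg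
      apply embedRat_injective m hc
      rw [embedRat_actQ hcd a _ hg, h]
    | one => exact actQ_one f
    | mul x y _ _ hx hy =>
      refine (actQ_mul _ _ f).trans ?_
      exact (congrArg _ hx).trans hy
    | inv x _ hx =>
      have h1 := actQ_mul (m := m + 1) (x : Matrix (Fin (m + 1)) (Fin (m + 1)) ℚ)
        ((x⁻¹ : GL (Fin (m + 1)) ℚ) : Matrix (Fin (m + 1)) (Fin (m + 1)) ℚ) f
      have h2 : (x : Matrix (Fin (m + 1)) (Fin (m + 1)) ℚ) *
          ((x⁻¹ : GL (Fin (m + 1)) ℚ) : Matrix (Fin (m + 1)) (Fin (m + 1)) ℚ) = 1 :=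
        Units.mul_inv x
      rw [h2, actQ_one] at h1
      exact (congrArg _ hx.symm).trans h1.symm

/-- The invariant ring, as a subalgebra of `R[x_1, …, x_{n-1}]`: the polynomials which become
symmetric under `embed`. -/
noncomputable def invariants (m c : ℕ) (R : Subring ℚ) :
    Subalgebra R (MvPolynomial (Fin (m + 1)) R) :=
  ((symmetricSubalgebra (Fin (m + 2)) ℚ).restrictScalars R).comap (embed m c R)

theorem mem_invariants {m c : ℕ} {R : Subring ℚ} {f : MvPolynomial (Fin (m + 1)) R} :
    f ∈ invariants m c R ↔ (embed m c R f).IsSymmetric := Iff.rfl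

theorem invariantRingQ_eq_map {m c d : ℕ} (hcd : c * d = m + 2) (R : Subring ℚ) :
    invariantRingQ R (group m d)
      = (invariants m c R).map (mapAlgHom (Algebra.ofId R ℚ)) := by
  ext f
  have hinf : f ∈ Subalgebra.restrictScalars R
      (⨅ g ∈ group m d,
        AlgHom.equalizer (actQ (g : Matrix (Fin (m + 1)) (Fin (m + 1)) ℚ)) (AlgHom.id ℚ _))
      ↔ (embedRat m c f).IsSymmetric := by
    rw [← fixed_iff_isSymmetric hcd, Subalgebra.mem_restrictScalars]
    simp only [Algebra.mem_iInf, AlgHom.mem_equalizer, AlgHom.id_apply]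
  rw [invariantRingQ, Algebra.mem_inf, Subalgebra.mem_map]
  refine (and_congr_right fun _ => hinf).trans ⟨?_, ?_⟩
  · rintro ⟨⟨g, rfl⟩, h⟩
    refine ⟨g, ?_, rfl⟩
    rw [mem_invariants, ← embedRat_map]
    exact h
  · rintro ⟨g, hg, rfl⟩
    refine ⟨⟨g, rfl⟩, ?_⟩
    rw [mem_invariants, ← embedRat_map] at hg
    exact hg

theorem isPolynomialRingQ_iff {m c d : ℕ} (hcd : c * d = m + 2) (R : Subring ℚ) :
    IsPolynomialRingQ R (craigGroup (m + 2) d) ↔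
      ∃ k : ℕ, Nonempty (invariants m c R ≃ₐ[R] MvPolynomial (Fin k) R) := by
  have e : invariants m c R ≃ₐ[R] invariantRingQ R (group m d) :=
    ((invariants m c R).equivMapOfInjective (mapAlgHom (Algebra.ofId R ℚ))
      (map_injective (Algebra.ofId R ℚ : R →+* ℚ) Subtype.val_injective)).trans
      (Subalgebra.equivOfEq _ _ (invariantRingQ_eq_map hcd R).symm)
  refine (iff_of_eq (congrArg (IsPolynomialRingQ (m := m + 1) R) (craigGroup_eq m d))).trans ?_
  exact ⟨fun ⟨k, ⟨f⟩⟩ => ⟨k, ⟨e.trans f⟩⟩, fun ⟨k, ⟨f⟩⟩ => ⟨k, ⟨e.symm.trans f⟩⟩⟩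

end Craig

namespace Craig

section

variable {m c d : ℕ} (hcd : c * d = m + 2) (R : Subring ℚ)

theorem embed_X_zero :
    embed m c R (X 0) = -C (c : ℚ) * (X 1 - C ((m + 2 : ℚ)⁻¹) * ∑ i, X i) := by
  simp [embed, linForm]

theorem embed_X_succ (b : Fin m) :
    embed m c R (X b.succ) = X b.succ.castSucc - X b.succ.succ := by
  simp [embed, linForm]

include hcd in
theorem root_mem_range (i k : Fin (m + 2)) : X i - X k ∈ (embed m c R).range := by
  have hadj : ∀ a : Fin (m + 1), X a.castSucc - X a.succ ∈ (embed m c R).range := by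
    intro a
    refine Fin.cases ?_ (fun b => ?_) a
    · refine ⟨∑ b : Fin (m + 1),
        ((if b = 0 then d else m + 1 - b : ℕ) : MvPolynomial (Fin (m + 1)) R) * X b, ?_⟩
      rw [← sum_vMat_mul_linForm hcd]
      change embed m c R _ = _
      simp only [map_sum, map_mul, map_natCast, vMat_apply, if_true]
      refine Finset.sum_congr rfl fun b _ => ?_
      rw [embed, aeval_X, ← Nat.cast_ite, map_natCast]
    · exact ⟨X b.succ, embed_X_succ R b⟩
  have hzero : ∀ i : Fin (m + 2), X 0 - X i ∈ (embed m c R).range := by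
    intro i
    induction i using Fin.induction with
    | zero => rw [sub_self]; exact zero_mem _
    | succ i ih => rw [← sub_add_sub_cancel _ (X i.castSucc)]; exact add_mem ih (hadj i)
  rw [← sub_sub_sub_cancel_left _ _ (X 0)]
  exact sub_mem (hzero k) (hzero i)

include hcd in
theorem rename_mem_range (e : Equiv.Perm (Fin (m + 2))) (f : MvPolynomial (Fin (m + 1)) R) :
    rename e (embed m c R f) ∈ (embed m c R).range := by
  induction f using MvPolynomial.induction_on with
  | C a =>
    have : rename e (embed m c R (C a)) = embed m c R (C a) := by
      rw [← algebraMap_eq, AlgHom.commutes,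
        IsScalarTower.algebraMap_apply R ℚ (MvPolynomial (Fin (m + 2)) ℚ), AlgHom.commutes]
    rw [this]
    exact ⟨_, rfl⟩
  | add p q hp hq => rw [map_add, map_add]; exact add_mem hp hq
  | mul_X p b hp =>
    rw [map_mul, map_mul]
    refine mul_mem hp ?_
    refine Fin.cases ?_ (fun b => ?_) b
    · have h1 : rename e (embed m c R (X 0))
          = embed m c R (X 0) - embed m c R (c : _) * (X (e 1) - X 1) := by
        rw [embed_X_zero]
        simp only [map_mul, map_neg, map_sub, rename_C, rename_X, map_sum, map_natCast]
        rw [Equiv.sum_comp e fun i => (X i : MvPolynomial (Fin (m + 2)) ℚ)]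
        ring
      rw [h1]
      exact sub_mem ⟨_, rfl⟩ (mul_mem ⟨_, rfl⟩ (root_mem_range hcd R _ _))
    · rw [embed_X_succ, map_sub, rename_X, rename_X]
      exact root_mem_range hcd R _ _

theorem eval_embed_mem (v : Fin (m + 2) → ℤ) (hv : ∑ i, v i = 0)
    (f : MvPolynomial (Fin (m + 1)) R) :
    eval (fun i => (v i : ℚ)) (embed m c R f) ∈ R := by
  have hsum : ∑ i, (v i : ℚ) = 0 := by exact_mod_cast hv
  let r : Fin (m + 1) → R :=
    Fin.cons (-c * (v 1 : R)) fun b : Fin m => (v b.succ.castSucc : R) - v b.succ.succ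
  have : (eval fun i => (v i : ℚ)).comp (embed m c R : _ →+* _) = R.subtype.comp (eval r) := by
    apply ringHom_ext
    · intro a
      change eval _ (embed m c R (algebraMap R _ a)) = _
      rw [AlgHom.commutes, IsScalarTower.algebraMap_apply R ℚ (MvPolynomial (Fin (m + 2)) ℚ),
        algebraMap_eq, eval_C]
      simp
      rfl
    · intro b
      refine Fin.cases ?_ (fun b => ?_) b
      · change eval _ (embed m c R (X 0)) = _
        rw [embed_X_zero]
        simp [r, hsum]
      · change eval _ (embed m c R (X b.succ)) = _
        rw [embed_X_succ]
        simp [r]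
  have h := DFunLike.congr_fun this f
  change eval _ (embed m c R f) = ((eval r f : R) : ℚ) at h
  rw [h]
  exact (eval r f).2

/-- The invariant ring contains no linear forms. -/
theorem coeff_zero_of_isSymmetric (hc : c ≠ 0) {f : MvPolynomial (Fin (m + 1)) R}
    (hf : (embed m c R f).IsSymmetric) : coeff (Finsupp.single 0 1) f = 0 := by
  let v : Fin (m + 2) → ℚ := Fin.cons (m + 1) fun _ => -1
  let s : Fin (m + 1) → ℚ := Fin.cons c fun _ => 0
  have hv : ∑ i, v i = 0 := by simp [v, Fin.sum_univ_succ (n := m + 1)]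
  let H : MvPolynomial (Fin (m + 2)) ℚ →ₐ[ℚ] Polynomial ℚ :=
    aeval fun i => Polynomial.C (v i) * Polynomial.X
  have hH : (H.restrictScalars R).comp (embed m c R)
      = aeval fun b => Polynomial.C (s b) * Polynomial.X := by
    ext1 b
    refine Fin.cases ?_ (fun b => ?_) b
    · have hsum : H (∑ i, X i) = 0 := by
        simp only [H, map_sum, aeval_X, ← Finset.sum_mul]
        rw [← map_sum, hv, map_zero, zero_mul]
      have hX1 : H (X 1) = -Polynomial.X := by
        rw [← Fin.succ_zero_eq_one]
        simp [H, v]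
      rw [AlgHom.comp_apply, embed_X_zero, AlgHom.restrictScalars_apply, map_mul, map_sub,
        map_mul, hsum, hX1, aeval_X]
      simp [s]
    · rw [AlgHom.comp_apply, embed_X_succ, AlgHom.restrictScalars_apply, ← Fin.succ_castSucc]
      simp [H, v, s]
  have h1 := coeff_one_aeval_linear v (embed m c R f)
  have h2 := coeff_one_aeval_linear s f
  rw [← hH] at h2
  have h3 := h1.symm.trans h2
  simp only [hf.coeff_single _ 0, ← Finset.sum_mul, hv, zero_mul] at h3
  rw [Fin.sum_univ_succ] at h3
  simp only [s, Fin.cons_zero, Fin.cons_succ, zero_mul, Finset.sum_const_zero, add_zero] at h3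
  have h4 := (mul_eq_zero.1 h3.symm).resolve_left (by exact_mod_cast hc)
  exact Subtype.ext h4

include hcd in
/-- `S_n` acts faithfully on the reduction of Craig's lattice modulo a nonunit if `n ≥ 5`. -/
theorem exists_not_dvd (hm : 3 ≤ m) {q : R} (hq : ¬ IsUnit q)
    (e : Equiv.Perm (Fin (m + 2))) (he : e ≠ 1) :
    ∃ x : MvPolynomial (Fin (m + 1)) R, ∀ y u, embed m c R y = rename e (embed m c R x) →
      y - x ≠ C q * u := by
  obtain ⟨i, hi⟩ : ∃ i, e i ≠ i := by
    by_contra! h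
    exact he (Equiv.ext h)
  have exists_notMem : ∀ s : Finset (Fin (m + 2)), s.card ≤ 4 → ∃ a, a ∉ s := by
    intro s hs
    by_contra! h
    have := Finset.card_le_card (fun a _ => h a : Finset.univ ⊆ s)
    rw [Finset.card_univ, Fintype.card_fin] at this
    omega
  obtain ⟨k, hk⟩ := exists_notMem {i, e.symm i} (Finset.card_le_two.trans (by norm_num))
  obtain ⟨b, hb⟩ := exists_notMem {i, e i, k, e k} Finset.card_le_four
  simp only [Finset.mem_insert, Finset.mem_singleton, not_or] at hk hb
  have hek : e k ≠ i := fun h => hk.2 (by rw [← h, Equiv.symm_apply_apply])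
  obtain ⟨x, hx⟩ := root_mem_range hcd R i k
  change embed m c R x = _ at hx
  refine ⟨x, fun y u hy h => hq ?_⟩
  let v : Fin (m + 2) → ℤ := Pi.single i 1 - Pi.single b 1
  have hv : ∑ j, v j = 0 := by simp [v, Finset.sum_sub_distrib]
  have h' := congrArg (fun p => eval (fun i => (v i : ℚ)) (embed m c R p)) h
  simp only [map_sub, map_mul, hy, hx, rename_X, eval_X] at h'
  have hC : eval (fun i => (v i : ℚ)) (embed m c R (C q)) = q := by
    rw [← algebraMap_eq, AlgHom.commutes,
      IsScalarTower.algebraMap_apply R ℚ (MvPolynomial (Fin (m + 2)) ℚ), algebraMap_eq, eval_C]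
    rfl
  have v1 : v (e i) = 0 := by simp [v, hi, Ne.symm hb.2.1]
  have v2 : v (e k) = 0 := by simp [v, hek, Ne.symm hb.2.2.2]
  have v3 : v i = 1 := by simp [v, Ne.symm hb.1]
  have v4 : v k = 0 := by simp [v, hk.1, Ne.symm hb.2.2.1]
  rw [hC, v1, v2, v3, v4] at h'
  refine isUnit_iff_exists_inv.2 ⟨-⟨_, eval_embed_mem (c := c) R v hv u⟩, Subtype.ext ?_⟩
  push_cast at h' ⊢
  linarith

include hcd in
theorem not_nonempty_algEquiv (hm : 3 ≤ m) (hcR : (c : ℚ)⁻¹ ∉ R) (k : ℕ) :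
    ¬ Nonempty (invariants m c R ≃ₐ[R] MvPolynomial (Fin k) R) := by
  rintro ⟨E⟩
  have hc : c ≠ 0 := by rintro rfl; simp at hcd
  have inj := embed_injective m hc R
  obtain ⟨κ, _, ρ, q, hq0, ρ_surj, hρ, hρc⟩ := R.exists_residueField hc hcR
  have hqu : ¬ IsUnit q := fun h => by
    have := h.map ρ
    rw [(hρ q).2 dvd_rfl] at this
    exact not_isUnit_zero this
  have hρC : ∀ (σ : Type) (f : MvPolynomial σ R), map ρ f = 0 ↔ C q ∣ f := fun σ f =>
    (C_dvd_iff_map_hom_eq_zero ρ q hρ f).symm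
  choose act hact using fun e f => rename_mem_range hcd R e f
  replace hact : ∀ e f, embed m c R (act e f) = rename e (embed m c R f) := hact
  let τ : Equiv.Perm (Fin (m + 2)) →
      MvPolynomial (Fin (m + 1)) R →+* MvPolynomial (Fin (m + 1)) R := fun e =>
    { toFun := act e
      map_one' := inj (by simp [hact])
      map_mul' := fun x y => inj (by simp [hact])
      map_zero' := inj (by simp [hact])
      map_add' := fun x y => inj (by simp [hact]) }
  have hτ : ∀ e f, embed m c R (τ e f) = rename e (embed m c R f) := hact
  have hτC : ∀ e r, τ e (C r) = C r := fun e r => inj (by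
    rw [hτ, ← algebraMap_eq, AlgHom.commutes,
      IsScalarTower.algebraMap_apply R ℚ (MvPolynomial (Fin (m + 2)) ℚ), AlgHom.commutes])
  let j : invariants m c R →+* MvPolynomial (Fin (m + 1)) R := (invariants m c R).val.toRingHom
  let ψ : invariants m c R →+* MvPolynomial (Fin k) κ :=
    (map ρ).comp (E : invariants m c R →+* MvPolynomial (Fin k) R)
  have hj : ∀ x, (∃ a, j a = x) ↔ ∀ g, τ g x = x := fun x => by
    constructor
    · rintro ⟨y, rfl⟩ g
      exact inj ((hτ _ _).trans (y.2 g))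
    · intro h
      exact ⟨⟨x, fun g => by
        change rename g (embed m c R x) = embed m c R x
        rw [← hτ, h]⟩, rfl⟩
  have hψ : ∀ a, ψ a = 0 ↔ algebraMap R (invariants m c R) q ∣ a := fun a => by
    change map ρ (E a) = 0 ↔ _
    rw [hρC, ← algebraMap_eq, ← E.commutes]
    exact map_dvd_iff E
  obtain ⟨w, hw⟩ := exists_invariant_congruent (A := invariants m c R) τ
    (fun g h x => inj (by rw [hτ, hτ, hτ, rename_rename, Equiv.Perm.coe_mul]))
    (fun x => inj (by rw [hτ, Equiv.Perm.coe_one, rename_id_apply]))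
    (map ρ) (C q) (by simpa using hq0) (hρC _) (fun g => hτC g q)
    (fun g hg => by
      obtain ⟨x, hx⟩ := exists_not_dvd hcd R hm hqu g hg
      refine ⟨x, fun h => ?_⟩
      rw [← sub_eq_zero, ← map_sub, hρC] at h
      obtain ⟨u, hu⟩ := h
      exact hx _ u (hτ g x) hu)
    j Subtype.val_injective hj (algebraMap R _ q) rfl ψ
    ((map_surjective ρ ρ_surj).comp E.surjective) hψ
    (X 0)
    (fun g => by
      obtain ⟨y, hy⟩ := root_mem_range hcd R (g 1) 1
      change embed m c R y = _ at hy
      have : τ g (X 0) = X 0 - C (c : R) * y := inj (by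
        rw [hτ, map_sub, map_mul, hy, embed_X_zero]
        simp only [map_mul, map_neg, map_sub, rename_C, rename_X, map_sum, map_natCast]
        rw [Equiv.sum_comp g fun i => (X i : MvPolynomial (Fin (m + 2)) ℚ)]
        ring)
      rw [this, map_sub, map_mul, map_C, hρc, C_0, zero_mul, sub_zero])
  have h1 := congrArg (coeff (Finsupp.single 0 1)) hw
  rw [coeff_map, map_X, coeff_X, if_pos rfl] at h1
  change ρ (coeff (Finsupp.single 0 1) (w : MvPolynomial (Fin (m + 1)) R)) = 1 at h1
  rw [coeff_zero_of_isSymmetric R hc w.2, map_zero] at h1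
  exact zero_ne_one h1

end

end Craig

namespace Craig

section

variable {m c d : ℕ} (hcd : c * d = m + 2) (R : Subring ℚ)

/-- The projection along the invariant line onto the forms vanishing on it. -/
noncomputable def center (m : ℕ) (R : Subring ℚ) :
    MvPolynomial (Fin (m + 2)) R →ₐ[R] MvPolynomial (Fin (m + 2)) ℚ :=
  aeval fun i => X i - C ((m + 2 : ℚ)⁻¹) * ∑ k, X k

theorem center_X (i : Fin (m + 2)) :
    center m R (X i) = X i - C ((m + 2 : ℚ)⁻¹) * ∑ k, X k := aeval_X _ _

theorem center_rename (e : Equiv.Perm (Fin (m + 2))) (f : MvPolynomial (Fin (m + 2)) R) :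
    center m R (rename e f) = rename e (center m R f) := by
  refine DFunLike.congr_fun (?_ : (center m R).comp (rename e)
    = ((rename e).restrictScalars R).comp (center m R)) f
  ext1 i
  simp only [AlgHom.comp_apply, AlgHom.restrictScalars_apply, rename_X, center_X, map_sub,
    map_mul, rename_C, map_sum]
  rw [Equiv.sum_comp e fun i => (X i : MvPolynomial (Fin (m + 2)) ℚ)]

theorem center_sum_X : center m R (∑ i, X i) = 0 := by
  have : (m + 2 : MvPolynomial (Fin (m + 2)) ℚ) * C ((m + 2 : ℚ)⁻¹) = 1 := by
    have : (m + 2 : MvPolynomial (Fin (m + 2)) ℚ) = C (m + 2 : ℚ) := by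
      simp only [map_add, map_natCast, add_right_inj]
      exact (map_ofNat C 2).symm
    rw [this, ← C_mul, mul_inv_cancel₀ (by positivity), C_1]
  simp only [map_sum, center_X, Finset.sum_sub_distrib, Finset.sum_const, Finset.card_univ,
    Fintype.card_fin, nsmul_eq_mul]
  push_cast
  linear_combination (-∑ i, X i) * this

include hcd in
/-- If `c` is invertible then Craig's lattice is a quotient of the permutation lattice. -/
theorem exists_projection (hcR : (c : ℚ)⁻¹ ∈ R) :
    ∃ (p : MvPolynomial (Fin (m + 2)) R →ₐ[R] MvPolynomial (Fin (m + 1)) R)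
      (s : MvPolynomial (Fin (m + 1)) R →ₐ[R] MvPolynomial (Fin (m + 2)) R),
      (∀ f, embed m c R (p f) = center m R f) ∧ (∀ f, p (s f) = f) ∧
        ∀ f, (∑ i, X i) ∣ s (p f) - f := by
  have hc : c ≠ 0 := by rintro rfl; simp at hcd
  have inj := embed_injective m hc R
  let c' : R := ⟨(c : ℚ)⁻¹, hcR⟩
  have hc' : c' * c = 1 := Subtype.ext (inv_mul_cancel₀ (by exact_mod_cast hc : (c : ℚ) ≠ 0))
  have hcC : (C ((c : ℚ)⁻¹) * C (c : ℚ) : MvPolynomial (Fin (m + 2)) ℚ) = 1 := by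
    rw [← C_mul, inv_mul_cancel₀ (by exact_mod_cast hc), C_1]
  have embed_C : ∀ r : R, embed m c R (C r) = C (r : ℚ) := fun r => by
    rw [← algebraMap_eq, AlgHom.commutes,
      IsScalarTower.algebraMap_apply R ℚ (MvPolynomial (Fin (m + 2)) ℚ)]
    rfl
  have h1 : embed m c R (-C c' * X 0) = center m R (X 1) := by
    rw [map_mul, map_neg, embed_C, embed_X_zero, center_X]
    linear_combination (X 1 - C ((m + 2 : ℚ)⁻¹) * ∑ i, X i) * hcC
  have hW : ∀ i, ∃ w, embed m c R w = center m R (X i) := by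
    intro i
    obtain ⟨w, hw⟩ := root_mem_range hcd R i 1
    change embed m c R w = _ at hw
    refine ⟨w + -C c' * X 0, ?_⟩
    rw [map_add, h1, hw, center_X, center_X]
    ring
  choose W hW using hW
  let p : MvPolynomial (Fin (m + 2)) R →ₐ[R] MvPolynomial (Fin (m + 1)) R := aeval W
  let s : MvPolynomial (Fin (m + 1)) R →ₐ[R] MvPolynomial (Fin (m + 2)) R :=
    aeval (Fin.cons (-C (c : R) * X 1) fun b : Fin m => X b.succ.castSucc - X b.succ.succ)
  have hp : ∀ f, embed m c R (p f) = center m R f := fun f => by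
    refine DFunLike.congr_fun (?_ : (embed m c R).comp p = center m R) f
    ext1 i
    rw [AlgHom.comp_apply, aeval_X, hW]
  have hs0 : s (X 0) = -C (c : R) * X 1 := aeval_X _ _
  have hs : ∀ b : Fin m, s (X b.succ) = X b.succ.castSucc - X b.succ.succ := fun b => aeval_X _ _
  have hsC : ∀ r, s (C r) = C r := fun r => s.commutes r
  have hsW : ∀ i : Fin (m + 1), s (W i.succ) = X i.succ := by
    intro i
    induction i using Fin.induction with
    | zero =>
      have : W (Fin.succ 0) = -C c' * X 0 := inj (by rw [h1, hW, Fin.succ_zero_eq_one])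
      rw [this, map_mul, map_neg, hsC, hs0, Fin.succ_zero_eq_one]
      have : (C c' * C (c : R) : MvPolynomial (Fin (m + 2)) R) = 1 := by
        rw [← C_mul, hc', C_1]
      linear_combination X 1 * this
    | succ i ih =>
      have : W i.succ.succ = W i.castSucc.succ - X i.succ := inj (by
        rw [map_sub, hW, hW, center_X, center_X, embed_X_succ, Fin.succ_castSucc]
        ring)
      rw [this, map_sub, ih, hs, Fin.succ_castSucc]
      ring
  have hWsum : ∑ i, W i = 0 := inj (by
    rw [map_zero, map_sum, ← center_sum_X (m := m) R, map_sum]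
    exact Finset.sum_congr rfl fun i _ => hW i)
  have hsW0 : s (W 0) = X 0 - ∑ i, X i := by
    have := congrArg s hWsum
    rw [Fin.sum_univ_succ, map_add, map_sum, map_zero] at this
    simp only [hsW] at this
    rw [Fin.sum_univ_succ]
    linear_combination this
  refine ⟨p, s, hp, fun f => ?_, fun f => ?_⟩
  · refine DFunLike.congr_fun (?_ : p.comp s = AlgHom.id R _) f
    ext1 b
    apply inj
    rw [AlgHom.comp_apply, hp, AlgHom.id_apply]
    refine Fin.cases ?_ (fun b => ?_) b
    · rw [hs0, ← algebraMap_eq, map_mul, map_neg, AlgHom.commutes, center_X, embed_X_zero,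
        IsScalarTower.algebraMap_apply R ℚ (MvPolynomial (Fin (m + 2)) ℚ)]
      simp
    · rw [hs, map_sub, center_X, center_X, embed_X_succ]
      ring
  · rw [← Ideal.mem_span_singleton, ← Ideal.Quotient.eq]
    let Q := Ideal.Quotient.mkₐ R (Ideal.span {(∑ i, X i : MvPolynomial (Fin (m + 2)) R)})
    refine DFunLike.congr_fun (?_ : Q.comp (s.comp p) = Q) f
    ext1 i
    change Q (s (p (X i))) = _
    rw [show p (X i) = W i from aeval_X _ _]
    refine Fin.cases ?_ (fun i => ?_) i
    · rw [hsW0]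
      refine Ideal.Quotient.eq.2 (Ideal.mem_span_singleton.2 ⟨-1, by ring⟩)
    · rw [hsW]

include hcd in
theorem nonempty_algEquiv (hcR : (c : ℚ)⁻¹ ∈ R) :
    Nonempty (invariants m c R ≃ₐ[R] MvPolynomial (Fin (m + 1)) R) := by
  have hc : c ≠ 0 := by rintro rfl; simp at hcd
  have inj := embed_injective m hc R
  obtain ⟨p, s, hp, hps, hsp⟩ := exists_projection hcd R hcR
  let ε : MvPolynomial (Fin (m + 1)) R →ₐ[R] MvPolynomial (Fin (m + 2)) R :=
    aeval fun i : Fin (m + 1) => esymm (Fin (m + 2)) R (i + 2)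
  have hε : ∀ F (e : Equiv.Perm (Fin (m + 2))), rename e (ε F) = ε F := by
    intro F e
    rw [← AlgHom.comp_apply, comp_aeval]
    simp only [rename_esymm, ε]
  have hinv : ∀ F, p (ε F) ∈ invariants m c R := by
    intro F e
    change rename e (embed m c R (p (ε F))) = embed m c R (p (ε F))
    rw [hp, ← center_rename, hε]
  -- divisibility of `p (ε F)` by a scalar forces divisibility of `F`
  have descend : ∀ (r : R) f F, p (ε F) = C r * f → C r ∣ F := by
    intro r f F h
    obtain ⟨u, hu⟩ := hsp (ε F)
    let Q := Ideal.Quotient.mk (Ideal.span {r})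
    rw [C_dvd_iff_map_hom_eq_zero Q r
      (fun x => Ideal.Quotient.eq_zero_iff_mem.trans Ideal.mem_span_singleton)]
    apply eq_zero_of_sum_X_dvd_aeval_esymm
    refine ⟨-map Q u, ?_⟩
    have h1 : map Q (ε F) = aeval (fun i : Fin (m + 1) => esymm (Fin (m + 2)) _ (i + 2))
        (map Q F) := by
      let ε' : MvPolynomial (Fin (m + 1)) (R ⧸ Ideal.span {r}) →ₐ[R ⧸ Ideal.span {r}]
          MvPolynomial (Fin (m + 2)) (R ⧸ Ideal.span {r}) :=
        aeval fun i : Fin (m + 1) => esymm (Fin (m + 2)) (R ⧸ Ideal.span {r}) (i + 2)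
      refine DFunLike.congr_fun
        (?_ : (map Q).comp ε.toRingHom = ε'.toRingHom.comp (map Q)) F
      apply ringHom_ext
      · intro a
        simp [ε, ε']
      · intro i
        simp [ε, ε', map_esymm]
    have hr : Q r = 0 := Ideal.Quotient.eq_zero_iff_mem.2 (Ideal.mem_span_singleton_self r)
    rw [h, map_mul, ← algebraMap_eq, AlgHom.commutes, algebraMap_eq] at hu
    have := congrArg (map Q) hu
    rw [map_sub, map_mul, map_mul, map_C, hr, C_0, zero_mul, h1, map_sum] at this
    simp only [map_X] at this
    linear_combination -this
  let Θ : MvPolynomial (Fin (m + 1)) R →ₐ[R] invariants m c R :=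
    (p.comp ε).codRestrict _ hinv
  refine ⟨(AlgEquiv.ofBijective Θ ⟨?_, fun f => ?_⟩).symm⟩
  · rw [injective_iff_map_eq_zero]
    intro F hF
    have hF' : p (ε F) = 0 := congrArg Subtype.val hF
    have := descend 0 0 F (by rw [hF', mul_zero])
    rwa [C_0, zero_dvd_iff] at this
  · obtain ⟨f, hf⟩ := f
    let S : MvPolynomial (Fin (m + 2)) R := ∑ e : Equiv.Perm (Fin (m + 2)), rename e (s f)
    have hS : S.IsSymmetric := by
      intro e
      simp only [S, map_sum, rename_rename, ← Equiv.Perm.coe_mul]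
      exact Equiv.sum_comp (Equiv.mulLeft e) fun e => rename e (s f)
    have hpS : p S = C ((m + 2).factorial : R) * f := by
      apply inj
      have hterm : ∀ e : Equiv.Perm (Fin (m + 2)),
          embed m c R (p (rename e (s f))) = embed m c R f := fun e => by
        rw [hp, center_rename, ← hp, hps]
        exact hf e
      simp only [S, map_sum, hterm]
      simp [Fintype.card_perm]
    obtain ⟨H, hH⟩ := esymmAlgHom_surjective (n := m + 2) (σ := Fin (m + 2)) R (by simp) ⟨S, hS⟩
    have hHS : aeval (fun i : Fin (m + 2) => esymm (Fin (m + 2)) R (i + 1)) H = S := by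
      rw [← esymmAlgHom_apply, hH]
    let F : MvPolynomial (Fin (m + 1)) R := aeval (Fin.cons 0 X) H
    have hF : p (ε F) = p S := by
      rw [← hHS]
      refine DFunLike.congr_fun (?_ : (p.comp ε).comp (aeval (Fin.cons 0 X))
        = p.comp (aeval fun i : Fin (m + 2) => esymm (Fin (m + 2)) R (i + 1))) H
      ext1 i
      simp only [AlgHom.comp_apply, aeval_X]
      refine Fin.cases ?_ (fun i => ?_) i
      · apply inj
        rw [Fin.cons_zero, map_zero, map_zero, map_zero, hp, Fin.val_zero, zero_add, esymm_one,
          center_sum_X]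
      · rw [Fin.cons_succ, aeval_X]
        rfl
    obtain ⟨G, hG⟩ := descend _ f F (hF.trans hpS)
    refine ⟨G, Subtype.ext ?_⟩
    change p (ε G) = f
    have hN : (C ((m + 2).factorial : R) : MvPolynomial (Fin (m + 1)) R) ≠ 0 := by
      rw [Ne, C_eq_zero]
      exact_mod_cast (m + 2).factorial_ne_zero
    apply mul_left_cancel₀ hN
    rw [← hpS, ← hF, hG, map_mul, map_mul, ← algebraMap_eq, AlgHom.commutes, AlgHom.commutes]

end

end Craig

/-- let `R` be a ring with `ℤ ⊆ R ⊆ ℚ`, let `n ≥ 5`, let `d > 0` divide `n`,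
and let `L_d` be Craig's integral representation of `S_n` of rank `n-1`. Then
`R[L_d]^{S_n}` is isomorphic to a polynomial ring over `R` if and only if `d/n ∈ R`. -/
theorem craig_invariants_polynomial_iff (n d : ℕ) (hn : 5 ≤ n) (hd : d ∣ n) (hd0 : 0 < d)
    (R : Subring ℚ) :
    IsPolynomialRingQ R (craigGroup n d) ↔ (d : ℚ) / (n : ℚ) ∈ R := by
  obtain ⟨m, rfl⟩ : ∃ m, n = m + 2 := ⟨n - 2, by omega⟩
  obtain ⟨c, hc⟩ := hd
  have hcd : c * d = m + 2 := by rw [hc, mul_comm]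
  have hinv : (d : ℚ) / ((m + 2 : ℕ) : ℚ) = (c : ℚ)⁻¹ := by
    have hd' : (d : ℚ) ≠ 0 := by exact_mod_cast hd0.ne'
    rw [hc, Nat.cast_mul, div_mul_cancel_left₀ hd']
  rw [hinv, Craig.isPolynomialRingQ_iff hcd R]
  constructor
  · rintro ⟨k, hk⟩
    by_contra hcR
    exact Craig.not_nonempty_algEquiv hcd R (by omega) hcR k hk
  · exact fun hcR => ⟨m + 1, Craig.nonempty_algEquiv hcd R hcR⟩
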